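/- A discrete semigroup S is extremely left amenable if and only if any two elements of S have a common right zero, i.e., for all a, b ∈ S there exists c ∈ S with ac = bc = c. -/

import Mathlib

open BoundedContinuousFunction

/-- A discrete semigroup `S` is extremely left amenable: `ℓ∞(S)` (realized as the bounded
(automatically continuous) real functions on `S`) admits a multiplicative left invariant
mean. -/
def ExtremelyLeftAmenable (S : Type*) [Semigroup S] [TopologicalSpace S]
    [DiscreteTopology S] : Prop :=
  ∃ m : (S →ᵇ ℝ) →L[ℝ] ℝ, ‖m‖ = 1 ∧ m 1 = 1 ∧
    (∀ f g : S →ᵇ ℝ, m (f * g) = m f * m g) ∧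
    (∀ (s : S) (f : S →ᵇ ℝ),
      m (f.compContinuous ⟨fun t => s * t, continuous_of_discreteTopology⟩) = m f)

/-- Finite colouring for a self-map: `x` and `f x` get different colours unless equal. -/
theorem exists_finite_coloring {X : Type*} (f : X → X) :
    ∃ c : X → (Prop × Prop × Prop × Prop), ∀ x, c (f x) = c x → f x = x := by
  classical
  let s : Setoid X :=
    { r := fun x y => ∃ m n, f^[m] x = f^[n] y
      iseqv :=
        { refl := fun x => ⟨0, 0, rfl⟩
          symm := fun ⟨m, n, h⟩ => ⟨n, m, h.symm⟩
          trans := by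
            rintro x y z ⟨m, n, h⟩ ⟨p, q, h'⟩
            refine ⟨p + m, n + q, ?_⟩
            rw [Function.iterate_add_apply, h, ← Function.iterate_add_apply, Nat.add_comm p n,
              Function.iterate_add_apply, h', ← Function.iterate_add_apply] } }
  let r : X → X := fun x => (Quotient.mk s x).out
  have hr : ∀ x, ∃ m n, f^[m] x = f^[n] (r x) := fun x => by
    have h : s.r x (r x) := s.symm (Quotient.mk_out (s := s) x)
    exact h
  have hrf : ∀ x, r (f x) = r x := fun x => by
    have : (Quotient.mk s (f x)) = Quotient.mk s x := Quotient.sound ⟨0, 1, rfl⟩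
    simp only [r, this]
  let d : X → ℕ := fun x => Nat.find (hr x)
  have hd : ∀ x, ∃ n, f^[d x] x = f^[n] (r x) := fun x => Nat.find_spec (hr x)
  have hdle : ∀ x m n, f^[m] x = f^[n] (r x) → d x ≤ m := fun x m n h =>
    Nat.find_min' (hr x) ⟨n, h⟩
  let k : X → ℕ := fun x => sInf {n | x = f^[n] (r x)}
  have hk : ∀ x, d x = 0 → x = f^[k x] (r x) := fun x h => by
    have : {n | x = f^[n] (r x)}.Nonempty := by
      obtain ⟨n, hn⟩ := hd x
      rw [h] at hn
      exact ⟨n, hn⟩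
    exact Nat.sInf_mem this
  have hkle : ∀ x n, x = f^[n] (r x) → k x ≤ n := fun x n h => Nat.sInf_le h
  have hd1 : ∀ x, d x ≠ 0 → d (f x) + 1 = d x := fun x h => by
    obtain ⟨e, he⟩ := Nat.exists_eq_succ_of_ne_zero h
    obtain ⟨n, hn⟩ := hd x
    rw [he, Function.iterate_succ_apply] at hn
    have h1 := hdle (f x) e n (by rw [hn, hrf])
    obtain ⟨n', hn'⟩ := hd (f x)
    rw [← Function.iterate_succ_apply, hrf] at hn'
    have h2 := hdle x _ _ hn'
    omega
  have hd0 : ∀ x, d x = 0 → d (f x) = 0 := fun x h => by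
    have := hdle (f x) 0 (k x + 1) (by
      rw [Function.iterate_succ_apply', hrf, ← hk x h]; rfl)
    omega
  refine ⟨fun x => (d x = 0, Even (d x), Even (k x), k (f x) = k x + 1), fun x hx => ?_⟩
  simp only [Prod.mk.injEq, eq_iff_iff] at hx
  obtain ⟨h1, h2, h3, h4⟩ := hx
  by_cases h0 : d x = 0
  · have h0' := hd0 x h0
    by_cases hw : k (f x) = k x + 1
    · rw [hw, Nat.even_add_one] at h3
      tauto
    · have hw' : ¬ k (f (f x)) = k (f x) + 1 := fun h => hw (h4.1 h)
      have e0 := hk x h0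
      have e1 := hk (f x) h0'
      have e2 := hk (f (f x)) (hd0 _ h0')
      rw [hrf] at e1
      rw [hrf, hrf] at e2
      have l1 : k (f x) ≤ k x + 1 := hkle _ _ (by
        rw [Function.iterate_succ_apply', hrf, ← e0])
      have l2 : k (f (f x)) ≤ k (f x) + 1 := hkle _ _ (by
        rw [Function.iterate_succ_apply', hrf, hrf, ← e1])
      -- the orbit of the representative is exhausted by indices at most `k (f x)`
      have key : ∀ n, ∃ j ≤ k (f x), f^[n] (r x) = f^[j] (r x) := by
        intro n
        induction n with
        | zero => exact ⟨0, Nat.zero_le _, rfl⟩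
        | succ n ih =>
          obtain ⟨j, hj, e⟩ := ih
          rcases Nat.lt_or_ge j (k (f x)) with hlt | hge
          · exact ⟨j + 1, hlt, by
              rw [Function.iterate_succ_apply', e, ← Function.iterate_succ_apply' f j]⟩
          · have hjeq : j = k (f x) := le_antisymm hj hge
            refine ⟨k (f (f x)), by omega, ?_⟩
            rw [Function.iterate_succ_apply', e, hjeq, ← e1, ← e2]
      obtain ⟨j, hj, e⟩ := key (k x)
      have l3 : k x ≤ j := hkle x j (by rw [← e, ← e0])
      have : k (f x) = k x := by omega
      rw [e1, this, ← e0]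
  · have := hd1 x h0
    rw [← this, Nat.even_add_one] at h2
    tauto

theorem ultrafilter_fixed {X : Type*} (U : Ultrafilter X) (f : X → X)
    (h : ∀ A : Set X, A ∈ U → f ⁻¹' A ∈ U) : {x | f x = x} ∈ U := by
  obtain ⟨c, hc⟩ := exists_finite_coloring f
  obtain ⟨v, hv⟩ := Ultrafilter.eq_pure_of_finite (U.map c)
  have h1 : c ⁻¹' {v} ∈ U := by
    have : ({v} : Set _) ∈ U.map c := by rw [hv]; exact Set.mem_singleton v
    exact this
  filter_upwards [h1, h _ h1] with x hx hy
  exact hc x (hy.trans hx.symm)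

noncomputable def indB {S : Type*} [TopologicalSpace S] [DiscreteTopology S] (A : Set S) :
    S →ᵇ ℝ :=
  BoundedContinuousFunction.ofNormedAddCommGroup (A.indicator 1)
    continuous_of_discreteTopology 1 (fun x => by
      by_cases h : x ∈ A <;> simp [h])

theorem indB_apply {S : Type*} [TopologicalSpace S] [DiscreteTopology S] (A : Set S) (x : S) :
    indB A x = A.indicator 1 x := rfl

theorem ela_forward (S : Type*) [Semigroup S]
    [TopologicalSpace S] [DiscreteTopology S] (H : ExtremelyLeftAmenable S) (a b : S) :
    ∃ c : S, a * c = c ∧ b * c = c := by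
  obtain ⟨m, -, m1, mm, mi⟩ := H
  have inter : ∀ A B : Set S, indB (A ∩ B) = indB A * indB B := fun A B => by
    ext x
    by_cases h : x ∈ A <;> by_cases h' : x ∈ B <;> simp [indB_apply, h, h']
  have huniv : indB (Set.univ : Set S) = 1 := by ext x; simp [indB_apply]
  have hcompl : ∀ A : Set S, indB A + indB Aᶜ = 1 := fun A => by
    ext x
    by_cases h : x ∈ A <;> simp [indB_apply, h]
  have hc : ∀ A : Set S, m (indB A) + m (indB Aᶜ) = 1 := fun A => by
    rw [← map_add, hcompl, m1]
  have h01 : ∀ A : Set S, m (indB A) = 0 ∨ m (indB A) = 1 := fun A => by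
    have := mm (indB A) (indB A)
    rw [← inter, Set.inter_self] at this
    rcases eq_or_ne (m (indB A)) 0 with h | h
    · exact Or.inl h
    · exact Or.inr (mul_left_cancel₀ h (by rw [← this, mul_one]))
  let F : Filter S :=
    { sets := {A | m (indB A) = 1}
      univ_sets := by simp [huniv, m1]
      sets_of_superset := by
        intro A B hA hAB
        simp only [Set.mem_setOf_eq] at *
        have := mm (indB A) (indB B)
        rw [← inter, Set.inter_eq_left.2 hAB, hA, one_mul] at this
        exact this.symm
      inter_sets := by
        intro A B hA hB
        simp only [Set.mem_setOf_eq] at *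
        rw [inter, mm, hA, hB, one_mul] }
  have hF : ∀ A, A ∈ F ↔ m (indB A) = 1 := fun A => Iff.rfl
  let U : Ultrafilter S := Ultrafilter.ofComplNotMemIff F (fun A => by
    rw [hF, hF]
    have := hc A
    rcases h01 A with h | h <;> rw [h] at this ⊢
    · simp at this; simp [this]
    · have h' : m (indB Aᶜ) = 0 := by linarith
      simp [h'])
  have hU : ∀ A, A ∈ U ↔ m (indB A) = 1 := fun A => Iff.rfl
  have hfix : ∀ s : S, {x | s * x = x} ∈ U := fun s => by
    apply ultrafilter_fixed U (fun x => s * x)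
    intro A hA
    rw [hU] at *
    rw [← mi s] at hA
    exact hA
  obtain ⟨c, h1, h2⟩ := U.nonempty_of_mem (Filter.inter_mem (hfix a) (hfix b))
  exact ⟨c, h1, h2⟩

theorem ela_backward (S : Type*) [Semigroup S] [Nonempty S]
    [TopologicalSpace S] [DiscreteTopology S] (H : ∀ a b : S, ∃ c : S, a * c = c ∧ b * c = c) :
    ExtremelyLeftAmenable S := by
  let Z : S → Set S := fun a => {c | a * c = c}
  have hdir : Directed (· ≥ ·) (fun a => Filter.principal (Z a)) := by
    intro a b
    obtain ⟨c, h1, h2⟩ := H a b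
    refine ⟨c, ?_, ?_⟩ <;>
    · simp only [ge_iff_le, Filter.le_principal_iff, Filter.mem_principal]
      intro d (hd : c * d = d)
      change _ * d = d
      rw [← hd, ← mul_assoc]
      first | rw [h1] | rw [h2]
  have hne : (⨅ a, Filter.principal (Z a)).NeBot := by
    apply Filter.iInf_neBot_of_directed' hdir
    intro a
    obtain ⟨c, h, -⟩ := H a a
    exact Filter.principal_neBot_iff.2 ⟨c, h⟩
  let U : Ultrafilter S := Ultrafilter.of (⨅ a, Filter.principal (Z a))
  have hU : ∀ a, Z a ∈ U := fun a =>
    Ultrafilter.of_le _ (Filter.mem_iInf_of_mem a (Filter.mem_principal_self _))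
  have hlim : ∀ f : S →ᵇ ℝ, ∃ l : ℝ, ‖l‖ ≤ ‖f‖ ∧ Filter.Tendsto f U (nhds l) := by
    intro f
    obtain ⟨l, hl, hl'⟩ := (isCompact_closedBall (0 : ℝ) ‖f‖).ultrafilter_le_nhds (U.map f) (by
      rw [Filter.le_principal_iff]
      change f ⁻¹' _ ∈ U
      apply Filter.Eventually.of_forall
      intro x
      simpa using f.norm_coe_le_norm x)
    exact ⟨l, by simpa using hl, hl'⟩
  choose L hL1 hL2 using hlim
  have huniq : ∀ (f : S →ᵇ ℝ) (l : ℝ), Filter.Tendsto f U (nhds l) → L f = l := fun f l h =>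
    tendsto_nhds_unique (hL2 f) h
  let M : (S →ᵇ ℝ) →ₗ[ℝ] ℝ :=
    { toFun := L
      map_add' := fun f g => huniq _ _ ((hL2 f).add (hL2 g))
      map_smul' := fun c f => huniq _ _ ((hL2 f).const_mul c) }
  have hone : L 1 = 1 := huniq _ _ tendsto_const_nhds
  refine ⟨M.mkContinuous 1 (fun f => by rw [one_mul]; exact hL1 f), ?_, hone, ?_, ?_⟩
  · apply le_antisymm
    · exact LinearMap.mkContinuous_norm_le _ zero_le_one _
    · have := (M.mkContinuous 1 (fun f => by rw [one_mul]; exact hL1 f)).le_opNorm 1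
      have h2 : (M.mkContinuous 1 (fun f => by rw [one_mul]; exact hL1 f)) 1 = 1 := hone
      rw [h2] at this
      simpa using this
  · intro f g
    exact huniq _ _ ((hL2 f).mul (hL2 g))
  · intro s f
    apply huniq
    apply (hL2 f).congr'
    filter_upwards [hU s] with x hx
    change f x = f (s * x)
    rw [show s * x = x from hx]

/-- Granirer: a discrete semigroup is extremely left amenable iff any two elements have a
common right zero. -/
theorem extremelyLeftAmenable_iff_common_right_zero (S : Type*) [Semigroup S] [Nonempty S]
    [TopologicalSpace S] [DiscreteTopology S] :
    ExtremelyLeftAmenable S ↔ ∀ a b : S, ∃ c : S, a * c = c ∧ b * c = c :=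
  ⟨fun H a b => ela_forward S H a b, ela_backward S⟩
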